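/- Let (a_n)_{n∈ℕ^d} be a multisequence of complex numbers. Suppose there exists a family {μ_ξ}_{ξ∈Ξ} of positive Borel measures on ℝ^d such that a_n^ξ = ∫_{ℝ^d} x^n dμ_ξ(x) for all n ∈ N_1 ∪ 2N_1 and all ξ ∈ Ξ, and such that μ_0 = 0 and μ_{ξ+η} + μ_{ξ−η} − 2μ_η ≥ 0 for all ξ, η ∈ Ξ. Then (a_n) is a moment multisequence: there exists a positive Borel measure μ on ℝ^d with a_n = ∫_{ℝ^d} x^n dμ(x) for all n ∈ ℕ^d. -/

import Mathlib

open MeasureTheory Finsupp Complex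

noncomputable section

/-- `x^n = ∏ i, (x i)^(n i)` as a complex number, for `x ∈ ℝ^d`, `n ∈ ℕ^d`. -/
def rmom {d : ℕ} (x : Fin d → ℝ) (n : Fin d → ℕ) : ℂ := ∏ i, (x i : ℂ) ^ n i

/-- `a_n^ξ := ∑_{k,l} a_{n+k+l} ξ_k conj(ξ_l)`. -/
def aXi {d : ℕ} (a : (Fin d → ℕ) → ℂ) (ξ : (Fin d → ℕ) →₀ ℂ) (n : Fin d → ℕ) : ℂ :=
  ∑ k ∈ ξ.support, ∑ l ∈ ξ.support, a (n + k + l) * ξ k * (starRingEnd ℂ) (ξ l)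

/-- `n ∈ N₁ ∪ 2N₁`, where `N₁ = {k ∈ ℕ^d : |k| ≤ 1}`. -/
def truncIdx {d : ℕ} (n : Fin d → ℕ) : Prop :=
  (∑ i, n i ≤ 1) ∨ ∃ k : Fin d → ℕ, (∑ i, k i ≤ 1) ∧ n = fun i => 2 * k i

/-- A real function with bounded absolute value. -/
def AbsBdd {α : Type*} (g : α → ℝ) : Prop := ∃ C, ∀ x, |g x| ≤ C

/-- A finitely additive mean on the bounded functions on `α` (with junk values elsewhere). -/
structure FinMean (α : Type*) where
  /-- the value of the mean at a function -/
  val : (α → ℝ) → ℝ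
  add : ∀ g h, AbsBdd g → AbsBdd h → val (fun x => g x + h x) = val g + val h
  smul : ∀ (c : ℝ) g, AbsBdd g → val (fun x => c * g x) = c * val g
  nonneg : ∀ g, AbsBdd g → (∀ x, 0 ≤ g x) → 0 ≤ val g
  const : ∀ c : ℝ, val (fun _ => c) = c

namespace AbsBdd

variable {α β : Type*} {g h : α → ℝ}

lemma const (c : ℝ) : AbsBdd (fun _ : α => c) := ⟨|c|, fun _ => le_rfl⟩

lemma add (hg : AbsBdd g) (hh : AbsBdd h) : AbsBdd (fun x => g x + h x) := by
  obtain ⟨C, hC⟩ := hg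
  obtain ⟨D, hD⟩ := hh
  exact ⟨C + D, fun x => (abs_add_le _ _).trans (add_le_add (hC x) (hD x))⟩

lemma smul (c : ℝ) (hg : AbsBdd g) : AbsBdd (fun x => c * g x) := by
  obtain ⟨C, hC⟩ := hg
  exact ⟨|c| * C, fun x => by rw [abs_mul]; exact mul_le_mul_of_nonneg_left (hC x) (abs_nonneg c)⟩

lemma sub (hg : AbsBdd g) (hh : AbsBdd h) : AbsBdd (fun x => g x - h x) := by
  obtain ⟨C, hC⟩ := hg
  obtain ⟨D, hD⟩ := hh
  exact ⟨C + D, fun x => (abs_sub _ _).trans (add_le_add (hC x) (hD x))⟩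

lemma comp (hg : AbsBdd g) (f : β → α) : AbsBdd (fun x => g (f x)) := by
  obtain ⟨C, hC⟩ := hg
  exact ⟨C, fun x => hC _⟩

end AbsBdd

namespace FinMean

variable {α : Type*} (m : FinMean α) {g h : α → ℝ}

lemma sub (hg : AbsBdd g) (hh : AbsBdd h) : m.val (fun x => g x - h x) = m.val g - m.val h := by
  have h1 := m.add g (fun x => (-1) * h x) hg (hh.smul (-1))
  rw [m.smul (-1) h hh] at h1
  have h2 : (fun x => g x - h x) = fun x => g x + (-1) * h x := by
    funext x
    ring
  rw [h2, h1]
  ring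

lemma mono (hg : AbsBdd g) (hh : AbsBdd h) (hgh : ∀ x, g x ≤ h x) : m.val g ≤ m.val h := by
  have h1 := m.nonneg (fun x => h x - g x) (hh.sub hg) (fun x => sub_nonneg.2 (hgh x))
  rw [m.sub hh hg] at h1
  linarith

lemma abs_le {C : ℝ} (hC : ∀ x, |g x| ≤ C) : |m.val g| ≤ C := by
  have hg : AbsBdd g := ⟨C, hC⟩
  rw [_root_.abs_le]
  constructor
  · rw [← m.const (-C)]
    exact m.mono (AbsBdd.const _) hg fun x => (_root_.abs_le.1 (hC x)).1
  · rw [← m.const C]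
    exact m.mono hg (AbsBdd.const _) fun x => (_root_.abs_le.1 (hC x)).2

end FinMean

lemma AbsBdd.tendsto_limUnder {α : Type*} {g : α → ℝ} (hg : AbsBdd g) (U : Ultrafilter α) :
    Filter.Tendsto g U (nhds (Filter.limUnder (U : Filter α) g)) := by
  obtain ⟨C, hC⟩ := hg
  have h1 : ∀ x, g x ∈ Set.Icc (-C) C := fun x => abs_le.1 (hC x)
  obtain ⟨y, -, hy⟩ := (isCompact_Icc (a := -C) (b := C)).ultrafilter_le_nhds (U.map g) (by
    rw [Filter.le_principal_iff]
    exact Filter.mem_map.2 (Filter.univ_mem' h1))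
  exact tendsto_nhds_limUnder ⟨y, hy⟩

/-- The Cesàro means of a sequence. -/
def cesaroMean (g : ℕ → ℝ) (n : ℕ) : ℝ := (∑ j ∈ Finset.range (n + 1), g j) / (n + 1)

lemma abs_cesaroMean_le {g : ℕ → ℝ} {C : ℝ} (hC : ∀ x, |g x| ≤ C) (n : ℕ) :
    |cesaroMean g n| ≤ C := by
  have hn : (0 : ℝ) < n + 1 := by positivity
  rw [cesaroMean, abs_div, abs_of_pos hn, div_le_iff₀ hn]
  refine (Finset.abs_sum_le_sum_abs _ _).trans ((Finset.sum_le_sum fun j _ => hC j).trans ?_)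
  simp [mul_comm]

lemma AbsBdd.cesaroMean {g : ℕ → ℝ} (hg : AbsBdd g) : AbsBdd (cesaroMean g) := by
  obtain ⟨C, hC⟩ := hg
  exact ⟨C, abs_cesaroMean_le hC⟩

/-- Existence of a Banach limit. -/
lemma exists_shift_invariant_mean :
    ∃ m : FinMean ℕ, ∀ g, AbsBdd g → m.val (fun k => g (k + 1)) = m.val g := by
  let U : Ultrafilter ℕ := Filter.hyperfilter ℕ
  refine ⟨⟨fun g => Filter.limUnder (U : Filter ℕ) (cesaroMean g), ?_, ?_, ?_, ?_⟩, ?_⟩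
  · intro g h hg hh
    have h1 := (hg.cesaroMean.tendsto_limUnder U).add (hh.cesaroMean.tendsto_limUnder U)
    refine Filter.Tendsto.limUnder_eq (h1.congr fun n => ?_)
    simp [cesaroMean, Finset.sum_add_distrib, add_div]
  · intro c g hg
    have h1 := (hg.cesaroMean.tendsto_limUnder U).const_mul c
    refine Filter.Tendsto.limUnder_eq (h1.congr fun n => ?_)
    simp [cesaroMean, ← Finset.mul_sum, mul_div_assoc]
  · intro g hg h0
    refine ge_of_tendsto' (hg.cesaroMean.tendsto_limUnder U) fun n => ?_
    exact div_nonneg (Finset.sum_nonneg fun j _ => h0 j) (by positivity)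
  · intro c
    refine Filter.Tendsto.limUnder_eq (tendsto_const_nhds.congr fun n => ?_)
    have hn : (n : ℝ) + 1 ≠ 0 := by positivity
    simp [cesaroMean]
    field_simp
  · intro g hg
    have h1 := hg.cesaroMean.tendsto_limUnder U
    obtain ⟨C, hC⟩ := hg
    have h2 : Filter.Tendsto (fun n : ℕ => (g (n + 1) - g 0) / ((n : ℝ) + 1)) Filter.atTop
        (nhds 0) := by
      have h3 : Filter.Tendsto (fun n : ℕ => (2 * C) * (1 / ((n : ℝ) + 1))) Filter.atTop
          (nhds 0) := by
        simpa using (tendsto_one_div_add_atTop_nhds_zero_nat (𝕜 := ℝ)).const_mul (2 * C)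
      refine squeeze_zero_norm (fun n => ?_) h3
      have hn : (0 : ℝ) < n + 1 := by positivity
      rw [Real.norm_eq_abs, abs_div, abs_of_pos hn, mul_one_div]
      gcongr
      calc |g (n + 1) - g 0| ≤ |g (n + 1)| + |g 0| := abs_sub _ _
        _ ≤ 2 * C := by linarith [hC (n + 1), hC 0]
    have h4 := h1.add (h2.mono_left Nat.hyperfilter_le_atTop)
    rw [add_zero] at h4
    refine Filter.Tendsto.limUnder_eq (h4.congr fun n => ?_)
    simp only [cesaroMean]
    rw [← add_div]
    congr 1
    have h5 := Finset.sum_range_succ g (n + 1)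
    rw [Finset.sum_range_succ' g (n + 1)] at h5
    linarith

namespace FinMean

variable {G : Type*} [AddCommGroup G] (m : FinMean ℕ)

/-- Successive averaging along the cyclic subgroups generated by `s 0, s 1, …`. -/
def iterAvg (s : ℕ → G) : ℕ → (G → ℝ) → G → ℝ
  | 0, g => g
  | j + 1, g => fun x => m.val fun k => iterAvg s j g (x + k • s j)

lemma abs_iterAvg_le (s : ℕ → G) {g : G → ℝ} {C : ℝ} (hC : ∀ x, |g x| ≤ C) (j : ℕ) (x : G) :
    |m.iterAvg s j g x| ≤ C := by
  induction j generalizing x with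
  | zero => exact hC x
  | succ j ih => exact m.abs_le fun k => ih _

lemma absBdd_iterAvg (s : ℕ → G) {g : G → ℝ} (hg : AbsBdd g) (j : ℕ) :
    AbsBdd (m.iterAvg s j g) := by
  obtain ⟨C, hC⟩ := hg
  exact ⟨C, m.abs_iterAvg_le s hC j⟩

lemma absBdd_iterAvg_apply (s : ℕ → G) {g : G → ℝ} (hg : AbsBdd g) (x : G) :
    AbsBdd (fun j => m.iterAvg s j g x) := by
  obtain ⟨C, hC⟩ := hg
  exact ⟨C, fun j => m.abs_iterAvg_le s hC j x⟩

lemma iterAvg_add (s : ℕ → G) {g h : G → ℝ} (hg : AbsBdd g) (hh : AbsBdd h) (j : ℕ) (x : G) :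
    m.iterAvg s j (fun x => g x + h x) x = m.iterAvg s j g x + m.iterAvg s j h x := by
  induction j generalizing x with
  | zero => rfl
  | succ j ih =>
    simp only [iterAvg, ih]
    exact m.add _ _ ((m.absBdd_iterAvg s hg j).comp _) ((m.absBdd_iterAvg s hh j).comp _)

lemma iterAvg_smul (s : ℕ → G) (c : ℝ) {g : G → ℝ} (hg : AbsBdd g) (j : ℕ) (x : G) :
    m.iterAvg s j (fun x => c * g x) x = c * m.iterAvg s j g x := by
  induction j generalizing x with
  | zero => rfl
  | succ j ih =>
    simp only [iterAvg, ih]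
    exact m.smul _ _ ((m.absBdd_iterAvg s hg j).comp _)

lemma iterAvg_nonneg (s : ℕ → G) {g : G → ℝ} (hg : AbsBdd g) (h0 : ∀ x, 0 ≤ g x) (j : ℕ) (x : G) :
    0 ≤ m.iterAvg s j g x := by
  induction j generalizing x with
  | zero => exact h0 x
  | succ j ih => exact m.nonneg _ ((m.absBdd_iterAvg s hg j).comp _) fun k => ih _

lemma iterAvg_const (s : ℕ → G) (c : ℝ) (j : ℕ) (x : G) :
    m.iterAvg s j (fun _ => c) x = c := by
  induction j generalizing x with
  | zero => rfl
  | succ j ih =>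
    simp only [iterAvg, ih]
    exact m.const c

lemma iterAvg_translate (s : ℕ → G) (g : G → ℝ) (t : G) (j : ℕ) (x : G) :
    m.iterAvg s j (fun x => g (x + t)) x = m.iterAvg s j g (x + t) := by
  induction j generalizing x with
  | zero => rfl
  | succ j ih =>
    simp only [iterAvg, ih]
    congr 1
    funext k
    rw [add_right_comm]

lemma iterAvg_apply_add (hm : ∀ g, AbsBdd g → m.val (fun k => g (k + 1)) = m.val g) (s : ℕ → G)
    {g : G → ℝ} (hg : AbsBdd g) {i j : ℕ} (hij : i < j) (x : G) :
    m.iterAvg s j g (x + s i) = m.iterAvg s j g x := by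
  induction j generalizing x with
  | zero => omega
  | succ j ih =>
    simp only [iterAvg]
    rcases Nat.lt_succ_iff_lt_or_eq.1 hij with h | rfl
    · congr 1
      funext k
      rw [add_right_comm, ih h]
    · rw [← hm (fun k => m.iterAvg s i g (x + k • s i)) ((m.absBdd_iterAvg s hg i).comp _)]
      congr 1
      funext k
      rw [succ_nsmul', add_assoc]

lemma val_eq_of_eq_tail {m : FinMean ℕ}
    (hm : ∀ g, AbsBdd g → m.val (fun k => g (k + 1)) = m.val g)
    {g h : ℕ → ℝ} (hg : AbsBdd g) (hh : AbsBdd h) {N : ℕ} (hN : ∀ k, N ≤ k → g k = h k) :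
    m.val g = m.val h := by
  have key : ∀ u : ℕ → ℝ, AbsBdd u → ∀ n, m.val (fun k => u (k + n)) = m.val u := by
    intro u hu n
    induction n with
    | zero => rfl
    | succ n ih =>
      rw [← ih, ← hm (fun k => u (k + n)) (hu.comp _)]
      congr 1
      funext k
      congr 1
      ring
  rw [← key g hg N, ← key h hh N]
  congr 1
  funext k
  exact hN _ (by omega)

end FinMean

/-- Countable abelian groups are amenable. -/
lemma exists_translation_invariant_mean (G : Type*) [AddCommGroup G] [Countable G] :
    ∃ M : FinMean G, ∀ g, AbsBdd g → ∀ t, M.val (fun x => g (x + t)) = M.val g := by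
  obtain ⟨m, hm⟩ := exists_shift_invariant_mean
  obtain ⟨s, hs⟩ := exists_surjective_nat G
  refine ⟨⟨fun g => m.val fun j => m.iterAvg s j g 0, ?_, ?_, ?_, ?_⟩, ?_⟩
  · intro g h hg hh
    simp only [m.iterAvg_add s hg hh]
    exact m.add _ _ (m.absBdd_iterAvg_apply s hg 0) (m.absBdd_iterAvg_apply s hh 0)
  · intro c g hg
    simp only [m.iterAvg_smul s c hg]
    exact m.smul _ _ (m.absBdd_iterAvg_apply s hg 0)
  · intro g hg h0
    exact m.nonneg _ (m.absBdd_iterAvg_apply s hg 0) fun j => m.iterAvg_nonneg s hg h0 j 0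
  · intro c
    simp only [m.iterAvg_const]
    exact m.const c
  · intro g hg t
    obtain ⟨i, rfl⟩ := hs t
    refine FinMean.val_eq_of_eq_tail hm (m.absBdd_iterAvg_apply s (hg.comp _) 0)
      (m.absBdd_iterAvg_apply s hg 0) (N := i + 1) fun k hk => ?_
    rw [m.iterAvg_translate, m.iterAvg_apply_add hm s hg (by omega)]


section Parallelogram

variable {G : Type*} [AddCommGroup G] {q : G → ℝ}

/-- The polar form of a function satisfying the parallelogram law. -/
def polarForm (q : G → ℝ) (x y : G) : ℝ := (q (x + y) - q (x - y)) / 4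

variable (hq : ∀ x y, q (x + y) + q (x - y) = 2 * q x + 2 * q y)

include hq

lemma parallelogram_zero : q 0 = 0 := by
  have := hq 0 0
  simp only [add_zero, sub_zero] at this
  linarith

lemma parallelogram_neg (x : G) : q (-x) = q x := by
  have := hq 0 x
  simp only [zero_add, zero_sub, parallelogram_zero hq] at this
  linarith

lemma parallelogram_sub_comm (x y : G) : q (x - y) = q (y - x) := by
  rw [← parallelogram_neg hq, neg_sub]

lemma polarForm_comm (x y : G) : polarForm q x y = polarForm q y x := by
  rw [polarForm, polarForm, add_comm, parallelogram_sub_comm hq]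

lemma polarForm_self (x : G) : polarForm q x x = q x := by
  have := hq x x
  rw [polarForm]
  rw [sub_self, parallelogram_zero hq] at *
  linarith

lemma polarForm_add_left (x y z : G) :
    polarForm q (x + y) z = polarForm q x z + polarForm q y z := by
  have key : ∀ x y, polarForm q (x + y) z + polarForm q (x - y) z = 2 * polarForm q x z := by
    intro x y
    have h1 := hq (x + z) y
    have h2 := hq (x - z) y
    simp only [polarForm]
    rw [show x + y + z = x + z + y by abel, show x + y - z = x - z + y by abel,
      show x - y + z = x + z - y by abel, show x - y - z = x - z - y by abel]
    linarith
  have hneg : polarForm q (y - x) z = - polarForm q (x - y) z := by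
    simp only [polarForm]
    rw [← parallelogram_neg hq (y - x + z), ← parallelogram_neg hq (y - x - z),
      show -(y - x + z) = x - y - z by abel, show -(y - x - z) = x - y + z by abel]
    ring
  have h1 := key x y
  have h2 := key y x
  rw [add_comm y x] at h2
  linarith

lemma polarForm_zsmul_left (n : ℤ) (x z : G) : polarForm q (n • x) z = n * polarForm q x z := by
  have := map_zsmul (AddMonoidHom.mk' (fun x => polarForm q x z)
    fun x y => polarForm_add_left hq x y z) n x
  simpa using this

lemma apply_add_eq_polarForm (x y : G) : q (x + y) = q x + q y + 2 * polarForm q x y := by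
  have := hq x y
  rw [polarForm]
  linarith

lemma apply_zsmul_add (a b c : ℤ) (u v z : G) : q (a • u + b • v + c • z) =
    a ^ 2 * q u + b ^ 2 * q v + c ^ 2 * q z + 2 * a * b * polarForm q u v
      + 2 * a * c * polarForm q u z + 2 * b * c * polarForm q v z := by
  have hz : ∀ (n : ℤ) x, q (n • x) = n ^ 2 * q x := by
    intro n x
    rw [← polarForm_self hq, polarForm_zsmul_left hq, polarForm_comm hq,
      polarForm_zsmul_left hq, polarForm_self hq]
    ring
  have hr : ∀ (n m : ℤ) x y, polarForm q (n • x) (m • y) = n * m * polarForm q x y := by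
    intro n m x y
    rw [polarForm_zsmul_left hq, polarForm_comm hq, polarForm_zsmul_left hq, polarForm_comm hq]
    ring
  rw [apply_add_eq_polarForm hq, apply_add_eq_polarForm hq, polarForm_add_left hq]
  simp only [hz, hr]
  ring

lemma parallelogram_real_nonneg (h0 : ∀ x, 0 ≤ q x) (a b c : ℝ) (u v z : G) :
    0 ≤ a ^ 2 * q u + b ^ 2 * q v + c ^ 2 * q z + 2 * a * b * polarForm q u v
      + 2 * a * c * polarForm q u z + 2 * b * c * polarForm q v z := by
  have hfl : ∀ a : ℝ, Filter.Tendsto (fun n : ℕ => (⌊a * (n + 1)⌋ : ℝ) / ((n : ℝ) + 1))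
      Filter.atTop (nhds a) := by
    intro a
    rw [← tendsto_sub_nhds_zero_iff]
    refine squeeze_zero_norm (fun n => ?_) (tendsto_one_div_add_atTop_nhds_zero_nat (𝕜 := ℝ))
    have hn : (0 : ℝ) < n + 1 := by positivity
    rw [Real.norm_eq_abs, show (⌊a * (n + 1)⌋ : ℝ) / ((n : ℝ) + 1) - a =
      (⌊a * (n + 1)⌋ - a * (n + 1)) / ((n : ℝ) + 1) by field_simp, abs_div, abs_of_pos hn]
    gcongr
    rw [abs_le]
    constructor <;> linarith [Int.floor_le (a * ((n : ℝ) + 1)),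
      Int.lt_floor_add_one (a * ((n : ℝ) + 1))]
  have ha := hfl a
  have hb := hfl b
  have hc := hfl c
  refine ge_of_tendsto' ((((((ha.pow 2).mul_const (q u)).add ((hb.pow 2).mul_const (q v))).add
    ((hc.pow 2).mul_const (q z))).add (((ha.const_mul 2).mul hb).mul_const (polarForm q u v))).add
    (((ha.const_mul 2).mul hc).mul_const (polarForm q u z)) |>.add
    (((hb.const_mul 2).mul hc).mul_const (polarForm q v z))) fun n => ?_
  have hn : (0 : ℝ) < n + 1 := by positivity
  have h1 := h0 (⌊a * ((n : ℝ) + 1)⌋ • u + ⌊b * ((n : ℝ) + 1)⌋ • v + ⌊c * ((n : ℝ) + 1)⌋ • z)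
  rw [apply_zsmul_add hq] at h1
  have h2 := div_nonneg h1 (sq_nonneg ((n : ℝ) + 1))
  refine h2.trans_eq ?_
  field_simp

lemma polarForm_eq_of_null (h0 : ∀ x, 0 ≤ q x) (c : ℝ) (u v z : G)
    (h : q u + c ^ 2 * q v ≤ 2 * c * polarForm q u v) :
    polarForm q u z = c * polarForm q v z := by
  by_contra hne
  set D := polarForm q u z - c * polarForm q v z with hD
  have hD0 : D ≠ 0 := sub_ne_zero.2 hne
  have key : ∀ t : ℝ, 0 ≤ q z + 2 * t * D := by
    intro t
    have h1 := parallelogram_real_nonneg hq h0 t (-c * t) 1 u v z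
    have h2 := mul_le_mul_of_nonneg_left h (sq_nonneg t)
    rw [hD]
    nlinarith
  have h1 := key (-(q z + 1) / (2 * D))
  have h2 : 2 * (-(q z + 1) / (2 * D)) * D = -(q z + 1) := by field_simp
  linarith

end Parallelogram

lemma toReal_rnDeriv_parallelogram {X : Type*} [MeasurableSpace X] {ρ₁ ρ₂ σ₁ σ₂ κ : Measure X}
    [IsFiniteMeasure ρ₁] [IsFiniteMeasure ρ₂] [IsFiniteMeasure σ₁] [IsFiniteMeasure σ₂]
    [IsFiniteMeasure κ] (h : ρ₁ + ρ₂ = (σ₁ + σ₁) + (σ₂ + σ₂)) :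
    ∀ᵐ x ∂κ, (ρ₁.rnDeriv κ x).toReal + (ρ₂.rnDeriv κ x).toReal =
      2 * (σ₁.rnDeriv κ x).toReal + 2 * (σ₂.rnDeriv κ x).toReal := by
  have h1 := Measure.rnDeriv_add' ρ₁ ρ₂ κ
  rw [h] at h1
  filter_upwards [h1, Measure.rnDeriv_add' (σ₁ + σ₁) (σ₂ + σ₂) κ, Measure.rnDeriv_add' σ₁ σ₁ κ,
    Measure.rnDeriv_add' σ₂ σ₂ κ, Measure.rnDeriv_lt_top ρ₁ κ, Measure.rnDeriv_lt_top ρ₂ κ,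
    Measure.rnDeriv_lt_top σ₁ κ, Measure.rnDeriv_lt_top σ₂ κ] with x h1 h2 h3 h4 l1 l2 l3 l4
  rw [h1] at h2
  simp only [Pi.add_apply] at h2 h3 h4
  rw [h3, h4] at h2
  have h5 := congrArg ENNReal.toReal h2
  rw [ENNReal.toReal_add l1.ne l2.ne, ENNReal.toReal_add (by finiteness) (by finiteness),
    ENNReal.toReal_add l3.ne l3.ne, ENNReal.toReal_add l4.ne l4.ne] at h5
  linarith

lemma exists_eq_add_single {d : ℕ} {n : Fin d → ℕ} (hn : n ≠ 0) :
    ∃ (m : Fin d → ℕ) (i : Fin d), n = m + Pi.single i 1 := by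
  obtain ⟨i, hi⟩ := Function.ne_iff.1 hn
  refine ⟨n - Pi.single i 1, i, (tsub_add_cancel_of_le ?_).symm⟩
  intro j
  rcases eq_or_ne j i with rfl | hj
  · simpa using Nat.one_le_iff_ne_zero.2 hi
  · simp [hj]

lemma integrable_coord_of_sq {d : ℕ} {κ : Measure (Fin d → ℝ)} [IsFiniteMeasure κ] {i : Fin d}
    (h : Integrable (fun x => x i ^ 2) κ) : Integrable (fun x => x i) κ := by
  refine ((integrable_const (1 : ℝ)).add h).mono' (measurable_pi_apply i).aestronglyMeasurable
    (Filter.Eventually.of_forall fun x => ?_)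
  rw [Real.norm_eq_abs, Pi.add_apply, abs_le]
  constructor <;> nlinarith [sq_nonneg (x i - 1), sq_nonneg (x i + 1)]

/-- A quadratic family of measures whose moments of degree at most two are compatible with the
shift `e n ↦ e (n + single i 1)` represents the corresponding multisequence. -/
theorem moments_of_quadratic_family {d : ℕ} {G : Type*} [AddCommGroup G] [Countable G]
    (ν : G → Measure (Fin d → ℝ)) [∀ ξ, IsFiniteMeasure (ν ξ)]
    (hpar : ∀ ξ η, ν (ξ + η) + ν (ξ - η) = (ν ξ + ν ξ) + (ν η + ν η))
    (hint : ∀ ξ i, Integrable (fun x => x i ^ 2) (ν ξ)) (e : (Fin d → ℕ) → G)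
    (hshift : ∀ n i, (ν (e (n + Pi.single i 1))).real Set.univ + ∫ x, x i ^ 2 ∂ν (e n) ≤
      ((∫ x, x i ∂ν (e (n + Pi.single i 1) + e n))
        - ∫ x, x i ∂ν (e (n + Pi.single i 1) - e n)) / 2) (n : Fin d → ℕ) :
    Integrable (fun x => ∏ i, x i ^ n i) (ν (e 0)) ∧
      ∫ x, ∏ i, x i ^ n i ∂ν (e 0) =
        ((ν (e n + e 0)).real Set.univ - (ν (e n - e 0)).real Set.univ) / 4 := by
  obtain ⟨κ, hκ, hac, -⟩ := exists_isFiniteMeasure_absolutelyContinuous (Measure.sum ν)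
  have hνκ : ∀ ξ, ν ξ ≪ κ := fun ξ => (Measure.absolutelyContinuous_sum_right ξ
    (Measure.AbsolutelyContinuous.refl _)).trans hac
  have hleb : ∀ ξ, (ν ξ).HaveLebesgueDecomposition κ := fun ξ =>
    Measure.haveLebesgueDecomposition_of_sigmaFinite _ _
  set w : G → (Fin d → ℝ) → ℝ := fun ξ x => ((ν ξ).rnDeriv κ x).toReal with hw
  have hw0 : ∀ x ξ, 0 ≤ w ξ x := fun x ξ => ENNReal.toReal_nonneg
  have hwint : ∀ ξ, Integrable (w ξ) κ := fun ξ => Measure.integrable_toReal_rnDeriv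
  have hwmass : ∀ ξ, ∫ x, w ξ x ∂κ = (ν ξ).real Set.univ := fun ξ =>
    Measure.integral_toReal_rnDeriv (hνκ ξ)
  have hwsmul : ∀ ξ (f : (Fin d → ℝ) → ℝ), ∫ x, w ξ x * f x ∂κ = ∫ x, f x ∂ν ξ := fun ξ f =>
    integral_rnDeriv_smul (hνκ ξ)
  have hwsmuli : ∀ ξ (f : (Fin d → ℝ) → ℝ), Integrable f (ν ξ) →
      Integrable (fun x => w ξ x * f x) κ := fun ξ f hf =>
    (integrable_rnDeriv_smul_iff (hνκ ξ)).2 hf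
  have hae1 : ∀ᵐ x ∂κ, ∀ ξ η, w (ξ + η) x + w (ξ - η) x = 2 * w ξ x + 2 * w η x := by
    rw [ae_all_iff]
    intro ξ
    rw [ae_all_iff]
    intro η
    exact toReal_rnDeriv_parallelogram (hpar ξ η)
  have hae2 : ∀ᵐ x ∂κ, ∀ n i, w (e (n + Pi.single i 1)) x + x i ^ 2 * w (e n) x ≤
      2 * x i * polarForm (fun ξ => w ξ x) (e (n + Pi.single i 1)) (e n) := by
    rw [ae_all_iff]
    intro n
    rw [ae_all_iff]
    intro i
    set u := e (n + Pi.single i 1) with hu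
    set v := e n
    have hx := fun ξ => integrable_coord_of_sq (hint ξ i)
    have hnn : 0 ≤ᵐ[κ] fun x => w u x + w v x * x i ^ 2
        - (w (u + v) x * x i - w (u - v) x * x i) / 2 := by
      filter_upwards [hae1] with x hx1
      have h1 := parallelogram_real_nonneg hx1 (hw0 x) 1 (- x i) 0 u v 0
      simp only [polarForm] at h1
      simp only [Pi.zero_apply]
      linarith
    have hi1 := hwsmuli v _ (hint v i)
    have hi2 := hwsmuli (u + v) _ (hx (u + v))
    have hi3 := hwsmuli (u - v) _ (hx (u - v))
    have hi4 : Integrable (fun x => w u x + w v x * x i ^ 2) κ := (hwint u).add hi1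
    have hi6 : Integrable (fun x => w (u + v) x * x i - w (u - v) x * x i) κ := hi2.sub hi3
    have hi5 : Integrable (fun x => (w (u + v) x * x i - w (u - v) x * x i) / 2) κ :=
      hi6.div_const 2
    have hzero : ∫ x, w u x + w v x * x i ^ 2
        - (w (u + v) x * x i - w (u - v) x * x i) / 2 ∂κ = 0 := by
      refine le_antisymm ?_ (integral_nonneg_of_ae hnn)
      rw [integral_sub hi4 hi5, integral_add (hwint u) hi1, integral_div, integral_sub hi2 hi3,
        hwmass, hwsmul, hwsmul, hwsmul]
      linarith [hshift n i]
    rw [integral_eq_zero_iff_of_nonneg_ae hnn (hi4.sub hi5)] at hzero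
    filter_upwards [hzero] with x hx0
    simp only [Pi.zero_apply] at hx0
    simp only [polarForm]
    linarith
  have hae3 : ∀ᵐ x ∂κ, ∀ n, (w (e n + e 0) x - w (e n - e 0) x) / 4 =
      w (e 0) x * ∏ i, x i ^ n i := by
    filter_upwards [hae1, hae2] with x h1 h2
    have key : ∀ k : ℕ, ∀ n : Fin d → ℕ, ∑ i, n i = k →
        polarForm (fun ξ => w ξ x) (e n) (e 0) = w (e 0) x * ∏ i, x i ^ n i := by
      intro k
      induction k with
      | zero =>
        intro n hn
        have : n = 0 := by
          funext i
          simpa using (Finset.sum_eq_zero_iff.1 hn) i (Finset.mem_univ i)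
        subst this
        simp [polarForm_self (q := fun ξ => w ξ x) h1]
      | succ k ih =>
        intro n hn
        have hn0 : n ≠ 0 := by
          rintro rfl
          simp at hn
        obtain ⟨m, i, rfl⟩ := exists_eq_add_single hn0
        have hm : ∑ j, m j = k := by
          simp only [Pi.add_apply, Finset.sum_add_distrib, Finset.sum_pi_single',
            Finset.mem_univ, if_true] at hn
          omega
        rw [polarForm_eq_of_null (q := fun ξ => w ξ x) h1 (hw0 x) (x i) _ _ (e 0) (h2 m i),
          ih m hm]
        simp only [Pi.add_apply, pow_add, Finset.prod_mul_distrib]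
        rw [Finset.prod_eq_single (f := fun j => x j ^ (Pi.single i 1 : Fin d → ℕ) j) i
          (fun j _ hj => by simp [hj]) (fun h => (h (Finset.mem_univ i)).elim)]
        simp
        ring
    intro n
    exact key _ n rfl
  have hi7 : Integrable (fun x => (w (e n + e 0) x - w (e n - e 0) x) / 4) κ :=
    ((hwint _).sub (hwint _)).div_const 4
  have hae4 : (fun x => (w (e n + e 0) x - w (e n - e 0) x) / 4) =ᵐ[κ]
      fun x => w (e 0) x * ∏ i, x i ^ n i := by
    filter_upwards [hae3] with x hx
    exact hx n
  refine ⟨(integrable_rnDeriv_smul_iff (hνκ (e 0))).1 (hi7.congr hae4), ?_⟩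
  rw [← hwsmul, ← integral_congr_ae hae4, integral_div, integral_sub (hwint _) (hwint _),
    hwmass, hwmass]


/-- The weight `1 + ∑ x_i ^ 2`. -/
def quadWeight {d : ℕ} (x : Fin d → ℝ) : ℝ := 1 + ∑ i, x i ^ 2

lemma one_le_quadWeight {d : ℕ} (x : Fin d → ℝ) : 1 ≤ quadWeight x :=
  le_add_of_nonneg_right (Finset.sum_nonneg fun i _ => sq_nonneg (x i))

lemma sq_le_quadWeight {d : ℕ} (x : Fin d → ℝ) (i : Fin d) : x i ^ 2 ≤ quadWeight x :=
  (Finset.single_le_sum (f := fun i => x i ^ 2) (fun i _ => sq_nonneg (x i))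
    (Finset.mem_univ i)).trans (le_add_of_nonneg_left zero_le_one)

lemma continuous_quadWeight {d : ℕ} : Continuous (quadWeight (d := d)) := by
  unfold quadWeight
  fun_prop

/-- Continuous functions of at most quadratic growth. -/
def QuadGrowth {d : ℕ} (ψ : (Fin d → ℝ) → ℝ) : Prop :=
  Continuous ψ ∧ ∃ C, ∀ x, |ψ x| ≤ C * quadWeight x

namespace QuadGrowth

variable {d : ℕ} {φ ψ : (Fin d → ℝ) → ℝ}

lemma add (hφ : QuadGrowth φ) (hψ : QuadGrowth ψ) : QuadGrowth (fun x => φ x + ψ x) := by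
  obtain ⟨hc, C, hC⟩ := hφ
  obtain ⟨hc', D, hD⟩ := hψ
  exact ⟨hc.add hc', C + D, fun x => (abs_add_le _ _).trans (by linarith [hC x, hD x])⟩

lemma smul (c : ℝ) (hφ : QuadGrowth φ) : QuadGrowth (fun x => c * φ x) := by
  obtain ⟨hc, C, hC⟩ := hφ
  refine ⟨hc.const_mul c, |c| * C, fun x => ?_⟩
  rw [abs_mul, mul_assoc]
  exact mul_le_mul_of_nonneg_left (hC x) (abs_nonneg c)

lemma sub (hφ : QuadGrowth φ) (hψ : QuadGrowth ψ) : QuadGrowth (fun x => φ x - ψ x) := by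
  convert hφ.add (hψ.smul (-1)) using 2
  ring

lemma abs (hφ : QuadGrowth φ) : QuadGrowth (fun x => |φ x|) := by
  obtain ⟨hc, C, hC⟩ := hφ
  exact ⟨hc.abs, C, fun x => by simpa using hC x⟩

lemma mul_of_abs_le_one (hφ : QuadGrowth φ) (hc : Continuous ψ) (h : ∀ x, |ψ x| ≤ 1) :
    QuadGrowth (fun x => φ x * ψ x) := by
  obtain ⟨hc', C, hC⟩ := hφ
  refine ⟨hc'.mul hc, C, fun x => ?_⟩
  rw [abs_mul]
  nlinarith [hC x, h x, abs_nonneg (φ x), abs_nonneg (ψ x)]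

lemma quadWeight : QuadGrowth (quadWeight (d := d)) :=
  ⟨continuous_quadWeight, 1, fun x => by
    rw [abs_of_nonneg (zero_le_one.trans (one_le_quadWeight x)), one_mul]⟩

lemma of_sq_le (hc : Continuous φ) (h : ∀ x, φ x ^ 2 ≤ _root_.quadWeight x) : QuadGrowth φ := by
  refine ⟨hc, 1, fun x => ?_⟩
  have h1 := one_le_quadWeight x
  have h2 := h x
  rw [abs_le]
  constructor <;> nlinarith

lemma coord_sq (i : Fin d) : QuadGrowth (fun x : Fin d → ℝ => x i ^ 2) := by
  refine ⟨by fun_prop, 1, fun x => ?_⟩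
  rw [abs_of_nonneg (sq_nonneg _), one_mul]
  exact sq_le_quadWeight x i

lemma of_hasCompactSupport (hc : Continuous φ) (h : HasCompactSupport φ) : QuadGrowth φ := by
  obtain ⟨C, hC⟩ := hc.bounded_above_of_compact_support h
  refine ⟨hc, C, fun x => (hC x).trans ?_⟩
  exact le_mul_of_one_le_right ((norm_nonneg _).trans (hC x)) (one_le_quadWeight x)

end QuadGrowth

/-- Positive linear functionals on the functions of at most quadratic growth (with junk values
elsewhere). -/
structure QuadFunctional (d : ℕ) where
  /-- the value of the functional at a function -/
  val : ((Fin d → ℝ) → ℝ) → ℝ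
  add : ∀ φ ψ, QuadGrowth φ → QuadGrowth ψ → val (fun x => φ x + ψ x) = val φ + val ψ
  smul : ∀ (c : ℝ) φ, QuadGrowth φ → val (fun x => c * φ x) = c * val φ
  nonneg : ∀ φ, QuadGrowth φ → (∀ x, 0 ≤ φ x) → 0 ≤ val φ

/-- Compactly supported cutoffs converging to `1`. -/
def quadCutoff (d n : ℕ) (x : Fin d → ℝ) : ℝ := max 0 (1 - (∑ i, x i ^ 2) / ((n : ℝ) + 1) ^ 2)

lemma continuous_quadCutoff (d n : ℕ) : Continuous (quadCutoff d n) := by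
  unfold quadCutoff
  fun_prop

lemma quadCutoff_nonneg {d : ℕ} (n : ℕ) (x : Fin d → ℝ) : 0 ≤ quadCutoff d n x := le_max_left _ _

lemma quadCutoff_le_one {d : ℕ} (n : ℕ) (x : Fin d → ℝ) : quadCutoff d n x ≤ 1 := by
  refine max_le zero_le_one (sub_le_self _ ?_)
  have := Finset.sum_nonneg fun i (_ : i ∈ Finset.univ) => sq_nonneg (x i)
  positivity

lemma abs_quadCutoff_le_one {d : ℕ} (n : ℕ) (x : Fin d → ℝ) : |quadCutoff d n x| ≤ 1 := by
  rw [abs_of_nonneg (quadCutoff_nonneg n x)]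
  exact quadCutoff_le_one n x

lemma hasCompactSupport_quadCutoff (d n : ℕ) : HasCompactSupport (quadCutoff d n) := by
  refine HasCompactSupport.intro (isCompact_closedBall (0 : Fin d → ℝ) ((n : ℝ) + 1)) ?_
  intro x hx
  have hn : (0 : ℝ) < n + 1 := by positivity
  rw [mem_closedBall_zero_iff, pi_norm_le_iff_of_nonneg hn.le] at hx
  push Not at hx
  obtain ⟨i, hi⟩ := hx
  have h1 : ((n : ℝ) + 1) ^ 2 ≤ x i ^ 2 := by
    rw [← sq_abs (x i)]
    exact pow_le_pow_left₀ hn.le hi.le 2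
  have h2 : x i ^ 2 ≤ ∑ i, x i ^ 2 := Finset.single_le_sum (f := fun i => x i ^ 2)
    (fun i _ => sq_nonneg (x i)) (Finset.mem_univ i)
  refine max_eq_left (sub_nonpos.2 ?_)
  rw [one_le_div (by positivity)]
  exact h1.trans h2

lemma tendsto_quadCutoff {d : ℕ} (x : Fin d → ℝ) :
    Filter.Tendsto (fun n => quadCutoff d n x) Filter.atTop (nhds 1) := by
  have h1 : Filter.Tendsto (fun n : ℕ => (1 : ℝ) - (∑ i, x i ^ 2) * (1 / ((n : ℝ) + 1)) ^ 2)
      Filter.atTop (nhds (1 - (∑ i, x i ^ 2) * 0 ^ 2)) :=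
    (((tendsto_one_div_add_atTop_nhds_zero_nat (𝕜 := ℝ)).pow 2).const_mul _).const_sub _
  have h2 := (tendsto_const_nhds (x := (0 : ℝ))).max h1
  simp only [ne_eq, OfNat.ofNat_ne_zero, not_false_eq_true, zero_pow, mul_zero, sub_zero,
    zero_le_one, sup_of_le_right] at h2
  refine h2.congr fun n => ?_
  rw [quadCutoff, one_div, inv_pow, div_eq_mul_inv]

lemma abs_mul_one_sub_quadCutoff_le {d : ℕ} (n : ℕ) (x : Fin d → ℝ) {t : ℝ}
    (ht : t ^ 2 ≤ quadWeight x) : |t - t * quadCutoff d n x| ≤ 1 / ((n : ℝ) + 1) * quadWeight x := by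
  have hn : (0 : ℝ) < n + 1 := by positivity
  set N : ℝ := (n : ℝ) + 1
  have h1 : 1 - quadCutoff d n x ≤ (∑ i, x i ^ 2) / N ^ 2 := by
    have := le_max_right 0 (1 - (∑ i, x i ^ 2) / N ^ 2)
    rw [quadCutoff]
    linarith
  have h2 : (∑ i, x i ^ 2) / N ^ 2 ≤ quadWeight x / N ^ 2 := by
    gcongr
    rw [quadWeight]
    linarith
  have h3 : 0 ≤ 1 - quadCutoff d n x := sub_nonneg.2 (quadCutoff_le_one n x)
  have h4 : 1 - quadCutoff d n x ≤ 1 := sub_le_self _ (quadCutoff_nonneg n x)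
  rw [show t - t * quadCutoff d n x = t * (1 - quadCutoff d n x) by ring, abs_mul, abs_of_nonneg h3]
  have h5 : |t| ≤ (t ^ 2 / N + N) / 2 := by
    have : 0 ≤ (|t| - N) ^ 2 / N := by positivity
    have h6 : (|t| - N) ^ 2 / N = t ^ 2 / N + N - 2 * |t| := by
      field_simp
      rw [← sq_abs t]
      ring
    linarith
  calc |t| * (1 - quadCutoff d n x) ≤ (t ^ 2 / N + N) / 2 * (1 - quadCutoff d n x) := by gcongr
    _ = t ^ 2 / N / 2 * (1 - quadCutoff d n x) + N / 2 * (1 - quadCutoff d n x) := by ring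
    _ ≤ quadWeight x / N / 2 * 1 + N / 2 * (quadWeight x / N ^ 2) := by
        gcongr
        · have := one_le_quadWeight x
          positivity
        · exact h1.trans h2
    _ = 1 / N * quadWeight x := by
        field_simp
        ring

namespace QuadFunctional

variable {d : ℕ} (L : QuadFunctional d) {φ ψ : (Fin d → ℝ) → ℝ}

lemma sub (hφ : QuadGrowth φ) (hψ : QuadGrowth ψ) :
    L.val (fun x => φ x - ψ x) = L.val φ - L.val ψ := by
  have h1 := L.add φ (fun x => (-1) * ψ x) hφ (hψ.smul (-1))
  rw [L.smul (-1) ψ hψ] at h1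
  have h2 : (fun x => φ x - ψ x) = fun x => φ x + (-1) * ψ x := by
    funext x
    ring
  rw [h2, h1]
  ring

lemma mono (hφ : QuadGrowth φ) (hψ : QuadGrowth ψ) (h : ∀ x, φ x ≤ ψ x) :
    L.val φ ≤ L.val ψ := by
  have h1 := L.nonneg (fun x => ψ x - φ x) (hψ.sub hφ) (fun x => sub_nonneg.2 (h x))
  rw [L.sub hψ hφ] at h1
  linarith

lemma abs_le (hφ : QuadGrowth φ) {C : ℝ} (h : ∀ x, |φ x| ≤ C * quadWeight x) :
    |L.val φ| ≤ C * L.val quadWeight := by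
  have hw := QuadGrowth.quadWeight (d := d)
  rw [_root_.abs_le, ← neg_mul, ← L.smul _ _ hw, ← L.smul _ _ hw]
  refine ⟨L.mono (hw.smul _) hφ fun x => ?_, L.mono hφ (hw.smul _) fun x => ?_⟩
  · rw [neg_mul]
    exact (_root_.abs_le.1 (h x)).1
  · exact (_root_.abs_le.1 (h x)).2

open CompactlySupported in
/-- The restriction to compactly supported functions. -/
def toCompactlySupported : C_c((Fin d → ℝ), ℝ) →ₚ[ℝ] ℝ :=
  PositiveLinearMap.mk₀
    { toFun := fun f => L.val f
      map_add' := fun f g => L.add f g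
        (.of_hasCompactSupport f.continuous f.hasCompactSupport)
        (.of_hasCompactSupport g.continuous g.hasCompactSupport)
      map_smul' := fun c f => L.smul c f
        (.of_hasCompactSupport f.continuous f.hasCompactSupport) }
    fun f hf => L.nonneg f (.of_hasCompactSupport f.continuous f.hasCompactSupport) hf

/-- The representing measure of the restriction to compactly supported functions. -/
def measure : Measure (Fin d → ℝ) := RealRMK.rieszMeasure L.toCompactlySupported

instance : L.measure.Regular := by
  unfold measure
  infer_instance

lemma integral_measure (hc : Continuous φ) (h : HasCompactSupport φ) :
    ∫ x, φ x ∂L.measure = L.val φ :=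
  RealRMK.integral_rieszMeasure L.toCompactlySupported ⟨⟨φ, hc⟩, h⟩

lemma lintegral_measure_le (hφ : QuadGrowth φ) (h0 : ∀ x, 0 ≤ φ x) :
    ∫⁻ x, ENNReal.ofReal (φ x) ∂L.measure ≤ ENNReal.ofReal (L.val φ) := by
  have hc : ∀ n, Continuous fun x => φ x * quadCutoff d n x := fun n =>
    hφ.1.mul (continuous_quadCutoff d n)
  have hs : ∀ n, HasCompactSupport fun x => φ x * quadCutoff d n x := fun n =>
    (hasCompactSupport_quadCutoff d n).mul_left
  have hlim : ∀ x, Filter.liminf (fun n => ENNReal.ofReal (φ x * quadCutoff d n x)) Filter.atTop =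
      ENNReal.ofReal (φ x) := by
    intro x
    refine Filter.Tendsto.liminf_eq (ENNReal.tendsto_ofReal ?_)
    simpa using (tendsto_quadCutoff x).const_mul (φ x)
  calc ∫⁻ x, ENNReal.ofReal (φ x) ∂L.measure
      = ∫⁻ x, Filter.liminf (fun n => ENNReal.ofReal (φ x * quadCutoff d n x)) Filter.atTop
          ∂L.measure := by simp only [hlim]
    _ ≤ Filter.liminf (fun n => ∫⁻ x, ENNReal.ofReal (φ x * quadCutoff d n x) ∂L.measure)
          Filter.atTop := lintegral_liminf_le fun n => (hc n).measurable.ennreal_ofReal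
    _ ≤ ENNReal.ofReal (L.val φ) := by
        refine Filter.liminf_le_of_frequently_le' (Filter.Frequently.of_forall fun n => ?_)
        rw [← ofReal_integral_eq_lintegral_ofReal
          ((hc n).integrable_of_hasCompactSupport (hs n))
          (Filter.Eventually.of_forall fun x => mul_nonneg (h0 x) (quadCutoff_nonneg n x)),
          L.integral_measure (hc n) (hs n)]
        exact ENNReal.ofReal_le_ofReal (L.mono
          (hφ.mul_of_abs_le_one (continuous_quadCutoff d n) (abs_quadCutoff_le_one n)) hφ
          fun x => mul_le_of_le_one_right (h0 x) (quadCutoff_le_one n x))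

lemma integrable_measure (hφ : QuadGrowth φ) : Integrable φ L.measure := by
  refine ⟨hφ.1.aestronglyMeasurable, ?_⟩
  rw [hasFiniteIntegral_iff_norm]
  exact (L.lintegral_measure_le hφ.abs fun x => abs_nonneg _).trans_lt ENNReal.ofReal_lt_top

lemma integral_measure_le (hφ : QuadGrowth φ) (h0 : ∀ x, 0 ≤ φ x) :
    ∫ x, φ x ∂L.measure ≤ L.val φ := by
  have h1 := L.lintegral_measure_le hφ h0
  rw [← ofReal_integral_eq_lintegral_ofReal (L.integrable_measure hφ)
    (Filter.Eventually.of_forall h0)] at h1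
  exact (ENNReal.ofReal_le_ofReal_iff (L.nonneg φ hφ h0)).1 h1

instance : IsFiniteMeasure L.measure := by
  have h1 : QuadGrowth fun _ : Fin d → ℝ => (1 : ℝ) :=
    .of_sq_le continuous_const fun x => by simpa using one_le_quadWeight x
  have h2 := L.integrable_measure h1
  rw [integrable_const_iff] at h2
  simpa using h2

lemma integral_measure_of_sq_le (hc : Continuous φ) (h : ∀ x, φ x ^ 2 ≤ quadWeight x) :
    ∫ x, φ x ∂L.measure = L.val φ := by
  have hφ := QuadGrowth.of_sq_le hc h
  have hcut : ∀ n, QuadGrowth fun x => φ x * quadCutoff d n x := fun n =>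
    hφ.mul_of_abs_le_one (continuous_quadCutoff d n) (abs_quadCutoff_le_one n)
  have h1 : Filter.Tendsto (fun n => ∫ x, φ x * quadCutoff d n x ∂L.measure) Filter.atTop
      (nhds (∫ x, φ x ∂L.measure)) := by
    refine tendsto_integral_of_dominated_convergence (fun x => |φ x|)
      (fun n => (hcut n).1.aestronglyMeasurable) (L.integrable_measure hφ.abs)
      (fun n => Filter.Eventually.of_forall fun x => ?_)
      (Filter.Eventually.of_forall fun x => ?_)
    · rw [Real.norm_eq_abs, abs_mul]
      exact mul_le_of_le_one_right (abs_nonneg _) (abs_quadCutoff_le_one n x)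
    · simpa using (tendsto_quadCutoff x).const_mul (φ x)
  have h2 : Filter.Tendsto (fun n => ∫ x, φ x * quadCutoff d n x ∂L.measure) Filter.atTop
      (nhds (L.val φ)) := by
    rw [← tendsto_sub_nhds_zero_iff]
    have h3 : Filter.Tendsto (fun n : ℕ => 1 / ((n : ℝ) + 1) * L.val quadWeight) Filter.atTop
        (nhds 0) := by
      simpa using (tendsto_one_div_add_atTop_nhds_zero_nat (𝕜 := ℝ)).mul_const (L.val quadWeight)
    refine squeeze_zero_norm (fun n => ?_) h3
    rw [L.integral_measure (hcut n).1 (hasCompactSupport_quadCutoff d n).mul_left, norm_sub_rev,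
      Real.norm_eq_abs, ← L.sub hφ (hcut n)]
    exact L.abs_le (hφ.sub (hcut n)) fun x => abs_mul_one_sub_quadCutoff_le n x (h x)
  exact tendsto_nhds_unique h1 h2

end QuadFunctional


section SecondDifference

variable {d : ℕ} {G : Type*} [AddCommGroup G] (μ : G → Measure (Fin d → ℝ))

/-- The integrals of `f` satisfy the parallelogram law along the family `μ`. -/
def IntegralParallelogram (f : (Fin d → ℝ) → ℝ) : Prop :=
  ∀ ξ η, ∫ x, f x ∂μ (η + ξ) + ∫ x, f x ∂μ (η - ξ) = 2 * ∫ x, f x ∂μ η + 2 * ∫ x, f x ∂μ ξ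

/-- The symmetric second difference of `η ↦ ∫ ψ ∂μ η` in the direction `ξ`. -/
def secondDiff (ψ : (Fin d → ℝ) → ℝ) (ξ η : G) : ℝ :=
  ∫ x, ψ x ∂μ (η + ξ) + ∫ x, ψ x ∂μ (η - ξ) - 2 * ∫ x, ψ x ∂μ η

lemma secondDiff_eq_of_integralParallelogram {ψ : (Fin d → ℝ) → ℝ}
    (h : IntegralParallelogram μ ψ) (ξ η : G) : secondDiff μ ψ ξ η = 2 * ∫ x, ψ x ∂μ ξ := by
  rw [secondDiff, h]
  ring

lemma secondDiff_add_add_sub (ψ : (Fin d → ℝ) → ℝ) (ξ ζ η : G) :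
    secondDiff μ ψ (ξ + ζ) η + secondDiff μ ψ (ξ - ζ) η =
      secondDiff μ ψ ζ (η + ξ) + secondDiff μ ψ ζ (η + -ξ) + 2 * secondDiff μ ψ ξ η := by
  simp only [secondDiff]
  rw [show η + ξ + ζ = η + (ξ + ζ) by abel, show η + ξ - ζ = η + (ξ - ζ) by abel,
    show η + -ξ + ζ = η - (ξ - ζ) by abel, show η + -ξ - ζ = η - (ξ + ζ) by abel,
    show η + -ξ = η - ξ by abel]
  ring

variable [∀ ξ, IsFiniteMeasure (μ ξ)] (hint : ∀ ξ i, Integrable (fun x => x i ^ 2) (μ ξ))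

include hint

omit [AddCommGroup G] in
lemma integrable_quadWeight (ξ : G) : Integrable quadWeight (μ ξ) :=
  (integrable_const (1 : ℝ)).add (integrable_finsetSum _ fun i _ => hint ξ i)

omit [AddCommGroup G] in
lemma QuadGrowth.integrable {ψ : (Fin d → ℝ) → ℝ} (hψ : QuadGrowth ψ) (ξ : G) :
    Integrable ψ (μ ξ) := by
  obtain ⟨hc, C, hC⟩ := hψ
  exact ((integrable_quadWeight μ hint ξ).const_mul C).mono' hc.aestronglyMeasurable
    (Filter.Eventually.of_forall hC)

lemma secondDiff_add {φ ψ : (Fin d → ℝ) → ℝ} (hφ : QuadGrowth φ) (hψ : QuadGrowth ψ) (ξ η : G) :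
    secondDiff μ (fun x => φ x + ψ x) ξ η = secondDiff μ φ ξ η + secondDiff μ ψ ξ η := by
  simp only [secondDiff, integral_add (hφ.integrable μ hint _) (hψ.integrable μ hint _)]
  ring

lemma secondDiff_nonneg (hpos : ∀ ξ η, μ η + μ η ≤ μ (η + ξ) + μ (η - ξ))
    {ψ : (Fin d → ℝ) → ℝ} (hψ : QuadGrowth ψ) (h0 : ∀ x, 0 ≤ ψ x) (ξ η : G) :
    0 ≤ secondDiff μ ψ ξ η := by
  have hi := hψ.integrable μ hint
  have h1 := integral_mono_measure (hpos ξ η) (Filter.Eventually.of_forall h0)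
    ((hi (η + ξ)).add_measure (hi (η - ξ)))
  rw [integral_add_measure (hi _) (hi _), integral_add_measure (hi _) (hi _)] at h1
  rw [secondDiff]
  linarith

omit [∀ ξ, IsFiniteMeasure (μ ξ)] hint in
lemma secondDiff_smul (c : ℝ) (ψ : (Fin d → ℝ) → ℝ) (ξ η : G) :
    secondDiff μ (fun x => c * ψ x) ξ η = c * secondDiff μ ψ ξ η := by
  simp only [secondDiff, integral_const_mul]
  ring

lemma integralParallelogram_quadWeight (h1 : IntegralParallelogram μ fun _ => 1)
    (h2 : ∀ i, IntegralParallelogram μ fun x => x i ^ 2) : IntegralParallelogram μ quadWeight := by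
  have h : ∀ ξ, ∫ x, quadWeight x ∂μ ξ = ∫ _, (1 : ℝ) ∂μ ξ + ∑ i, ∫ x, x i ^ 2 ∂μ ξ := by
    intro ξ
    unfold quadWeight
    rw [integral_add (integrable_const 1) (integrable_finsetSum _ fun i _ => hint ξ i),
      integral_finsetSum _ fun i _ => hint ξ i]
  intro ξ η
  have h3 := Finset.sum_congr rfl fun i (_ : i ∈ Finset.univ) => h2 i ξ η
  simp only [Finset.sum_add_distrib, ← Finset.mul_sum] at h3
  simp only [h]
  linarith [h1 ξ η]

lemma absBdd_secondDiff (hpos : ∀ ξ η, μ η + μ η ≤ μ (η + ξ) + μ (η - ξ))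
    (h1 : IntegralParallelogram μ fun _ => 1)
    (h2 : ∀ i, IntegralParallelogram μ fun x => x i ^ 2)
    {ψ : (Fin d → ℝ) → ℝ} (hψ : QuadGrowth ψ) (ξ : G) : AbsBdd (secondDiff μ ψ ξ) := by
  obtain ⟨C, hC⟩ := hψ.2
  have hw := QuadGrowth.quadWeight (d := d)
  refine ⟨C * (2 * ∫ x, quadWeight x ∂μ ξ), fun η => ?_⟩
  rw [← secondDiff_eq_of_integralParallelogram μ
    (integralParallelogram_quadWeight μ hint h1 h2) ξ η, ← secondDiff_smul μ, abs_le]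
  constructor
  · have := secondDiff_nonneg μ hint hpos ((hw.smul C).add hψ)
      (fun x => by linarith [(abs_le.1 (hC x)).1]) ξ η
    rw [secondDiff_add μ hint (hw.smul C) hψ] at this
    linarith
  · have := secondDiff_nonneg μ hint hpos ((hw.smul C).add (hψ.smul (-1)))
      (fun x => by linarith [(abs_le.1 (hC x)).2]) ξ η
    rw [secondDiff_add μ hint (hw.smul C) (hψ.smul (-1)), secondDiff_smul μ (-1)] at this
    linarith

/-- Averaging second differences over the group turns a superquadratic family of measures into a
quadratic one without changing the moments of degree at most one and without increasing the
diagonal second moments. -/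
theorem exists_quadratic_family [Countable G]
    (hpos : ∀ ξ η, μ η + μ η ≤ μ (η + ξ) + μ (η - ξ))
    (h1 : IntegralParallelogram μ fun _ => 1)
    (hx : ∀ i, IntegralParallelogram μ fun x => x i)
    (h2 : ∀ i, IntegralParallelogram μ fun x => x i ^ 2) :
    ∃ ν : G → Measure (Fin d → ℝ), (∀ ξ, IsFiniteMeasure (ν ξ)) ∧
      (∀ ξ η, ν (ξ + η) + ν (ξ - η) = (ν ξ + ν ξ) + (ν η + ν η)) ∧
      (∀ ξ i, Integrable (fun x => x i ^ 2) (ν ξ)) ∧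
      (∀ ξ, (ν ξ).real Set.univ = (μ ξ).real Set.univ) ∧
      (∀ ξ i, ∫ x, x i ∂ν ξ = ∫ x, x i ∂μ ξ) ∧
      ∀ ξ i, ∫ x, x i ^ 2 ∂ν ξ ≤ ∫ x, x i ^ 2 ∂μ ξ := by
  obtain ⟨M, hM⟩ := exists_translation_invariant_mean G
  have hbdd : ∀ {ψ : (Fin d → ℝ) → ℝ}, QuadGrowth ψ → ∀ ξ, AbsBdd (secondDiff μ ψ ξ) :=
    fun hψ ξ => absBdd_secondDiff μ hint hpos h1 h2 hψ ξ
  let L : G → QuadFunctional d := fun ξ =>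
    { val := fun ψ => M.val (secondDiff μ ψ ξ) / 2
      add := by
        intro φ ψ hφ hψ
        rw [← add_div, ← M.add _ _ (hbdd hφ ξ) (hbdd hψ ξ)]
        congr 2
        funext η
        exact secondDiff_add μ hint hφ hψ ξ η
      smul := by
        intro c φ hφ
        rw [← mul_div_assoc, ← M.smul _ _ (hbdd hφ ξ)]
        congr 2
        funext η
        exact secondDiff_smul μ c φ ξ η
      nonneg := by
        intro φ hφ h0
        exact div_nonneg (M.nonneg _ (hbdd hφ ξ) (secondDiff_nonneg μ hint hpos hφ h0 ξ))
          zero_le_two }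
  have hLval : ∀ ψ, IntegralParallelogram μ ψ → ∀ ξ, (L ξ).val ψ = ∫ x, ψ x ∂μ ξ := by
    intro ψ hψ ξ
    have : secondDiff μ ψ ξ = fun _ => 2 * ∫ x, ψ x ∂μ ξ :=
      funext fun η => secondDiff_eq_of_integralParallelogram μ hψ ξ η
    simp [L, this, M.const]
  have hLpar : ∀ ψ, QuadGrowth ψ → ∀ ξ ζ, (L (ξ + ζ)).val ψ + (L (ξ - ζ)).val ψ =
      2 * (L ξ).val ψ + 2 * (L ζ).val ψ := by
    intro ψ hψ ξ ζ
    have h3 : M.val (fun η => secondDiff μ ψ (ξ + ζ) η + secondDiff μ ψ (ξ - ζ) η) =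
        M.val (fun η => secondDiff μ ψ ζ (η + ξ) + secondDiff μ ψ ζ (η + -ξ)
          + 2 * secondDiff μ ψ ξ η) := by
      congr 1
      funext η
      exact secondDiff_add_add_sub μ ψ ξ ζ η
    rw [M.add _ _ (hbdd hψ _) (hbdd hψ _),
      M.add _ _ (((hbdd hψ ζ).comp _).add ((hbdd hψ ζ).comp _)) ((hbdd hψ ξ).smul 2),
      M.add _ _ ((hbdd hψ ζ).comp _) ((hbdd hψ ζ).comp _), M.smul _ _ (hbdd hψ ξ),
      hM _ (hbdd hψ ζ), hM _ (hbdd hψ ζ)] at h3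
    change M.val (secondDiff μ ψ (ξ + ζ)) / 2 + M.val (secondDiff μ ψ (ξ - ζ)) / 2 =
      2 * (M.val (secondDiff μ ψ ξ) / 2) + 2 * (M.val (secondDiff μ ψ ζ) / 2)
    linarith
  refine ⟨fun ξ => (L ξ).measure, fun ξ => inferInstance, ?_,
    fun ξ i => (L ξ).integrable_measure (.coord_sq i), ?_, ?_, ?_⟩
  · intro ξ η
    refine Measure.ext_of_integral_eq_on_compactlySupported fun f => ?_
    have hi : ∀ ζ, Integrable f (L ζ).measure := fun ζ =>
      f.continuous.integrable_of_hasCompactSupport f.hasCompactSupport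
    have hv : ∀ ζ, ∫ x, f x ∂(L ζ).measure = (L ζ).val f := fun ζ =>
      (L ζ).integral_measure f.continuous f.hasCompactSupport
    rw [integral_add_measure (hi _) (hi _),
      integral_add_measure ((hi _).add_measure (hi _)) ((hi _).add_measure (hi _)),
      integral_add_measure (hi _) (hi _), integral_add_measure (hi _) (hi _)]
    simp only [hv]
    linarith [hLpar f (.of_hasCompactSupport f.continuous f.hasCompactSupport) ξ η]
  · intro ξ
    have h3 := (L ξ).integral_measure_of_sq_le (φ := fun _ => 1) continuous_const
      fun x => by simpa using one_le_quadWeight x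
    rw [hLval _ h1] at h3
    simpa using h3
  · intro ξ i
    rw [(L ξ).integral_measure_of_sq_le (φ := fun x => x i) (continuous_apply i)
      fun x => sq_le_quadWeight x i, hLval _ (hx i)]
  · intro ξ i
    exact ((L ξ).integral_measure_le (.coord_sq i) fun x => sq_nonneg _).trans_eq
      (hLval _ (h2 i) ξ)

end SecondDifference


section TruncatedFamily

variable {d : ℕ} {a : (Fin d → ℕ) → ℂ}

/-- The sesquilinear form whose quadratic form is `ξ ↦ aXi a ξ n`. -/
def shiftForm (a : (Fin d → ℕ) → ℂ) (n : Fin d → ℕ) (ξ ζ : (Fin d → ℕ) →₀ ℂ) : ℂ :=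
  ξ.sum fun k c => ζ.sum fun l c' => a (n + k + l) * c * (starRingEnd ℂ) c'

lemma aXi_eq_shiftForm (n : Fin d → ℕ) (ξ : (Fin d → ℕ) →₀ ℂ) :
    aXi a ξ n = shiftForm a n ξ ξ := rfl

lemma shiftForm_add_left (n : Fin d → ℕ) (ξ η ζ : (Fin d → ℕ) →₀ ℂ) :
    shiftForm a n (ξ + η) ζ = shiftForm a n ξ ζ + shiftForm a n η ζ := by
  refine Finsupp.sum_add_index' (by simp) fun k c c' => ?_
  simp only [mul_add, add_mul, Finsupp.sum_add]

lemma shiftForm_add_right (n : Fin d → ℕ) (ξ η ζ : (Fin d → ℕ) →₀ ℂ) :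
    shiftForm a n ζ (ξ + η) = shiftForm a n ζ ξ + shiftForm a n ζ η := by
  simp only [shiftForm, ← Finsupp.sum_add]
  refine Finsupp.sum_congr fun k _ => ?_
  exact Finsupp.sum_add_index' (by simp) fun l c c' => by simp [mul_add]

lemma shiftForm_neg_left (n : Fin d → ℕ) (ξ ζ : (Fin d → ℕ) →₀ ℂ) :
    shiftForm a n (-ξ) ζ = -shiftForm a n ξ ζ := by
  rw [eq_neg_iff_add_eq_zero, ← shiftForm_add_left, neg_add_cancel]
  exact Finsupp.sum_zero_index

lemma shiftForm_neg_right (n : Fin d → ℕ) (ξ ζ : (Fin d → ℕ) →₀ ℂ) :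
    shiftForm a n ζ (-ξ) = -shiftForm a n ζ ξ := by
  rw [eq_neg_iff_add_eq_zero, ← shiftForm_add_right, neg_add_cancel]
  simp [shiftForm]

lemma shiftForm_single (n k l : Fin d → ℕ) :
    shiftForm a n (single k 1) (single l 1) = a (n + k + l) := by
  simp [shiftForm]

lemma aXi_single (n k : Fin d → ℕ) : aXi a (single k 1) n = a (n + k + k) := by
  rw [aXi_eq_shiftForm, shiftForm_single]

lemma aXi_add_add_aXi_sub (n : Fin d → ℕ) (ξ η : (Fin d → ℕ) →₀ ℂ) :
    aXi a (η + ξ) n + aXi a (η - ξ) n = 2 * aXi a η n + 2 * aXi a ξ n := by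
  simp only [aXi_eq_shiftForm, sub_eq_add_neg, shiftForm_add_left, shiftForm_add_right,
    shiftForm_neg_left, shiftForm_neg_right]
  ring

lemma aXi_add_sub_aXi_sub_single (n k l : Fin d → ℕ) :
    aXi a (single k 1 + single l 1) n - aXi a (single k 1 - single l 1) n =
      4 * a (n + k + l) := by
  simp only [aXi_eq_shiftForm, sub_eq_add_neg, shiftForm_add_left, shiftForm_add_right,
    shiftForm_neg_left, shiftForm_neg_right, shiftForm_single, add_right_comm n l k]
  ring

lemma rmom_eq_ofReal (x : Fin d → ℝ) (n : Fin d → ℕ) :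
    rmom x n = ((∏ i, x i ^ n i : ℝ) : ℂ) := by
  simp [rmom]

lemma prod_pow_single (x : Fin d → ℝ) (i : Fin d) (c : ℕ) :
    ∏ j, x j ^ (Pi.single i c : Fin d → ℕ) j = x i ^ c := by
  rw [Finset.prod_eq_single i] <;> simp +contextual

lemma truncIdx_zero : truncIdx (0 : Fin d → ℕ) := Or.inl (by simp)

lemma truncIdx_single_one (i : Fin d) : truncIdx (Pi.single i 1) := Or.inl (by simp)

lemma truncIdx_single_two (i : Fin d) : truncIdx (Pi.single i 2) := by
  refine Or.inr ⟨Pi.single i 1, by simp, ?_⟩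
  ext j
  obtain rfl | h := eq_or_ne j i <;> simp [*]

variable {μ : ((Fin d → ℕ) →₀ ℂ) → Measure (Fin d → ℝ)}
  (hmom : ∀ ξ : (Fin d → ℕ) →₀ ℂ, ∀ n : Fin d → ℕ, truncIdx n →
    Integrable (fun x => rmom x n) (μ ξ) ∧ aXi a ξ n = ∫ x, rmom x n ∂(μ ξ))

include hmom

lemma integrable_and_aXi_eq {n : Fin d → ℕ} (hn : truncIdx n) {f : (Fin d → ℝ) → ℝ}
    (hf : ∀ x, ∏ i, x i ^ n i = f x) (ξ : (Fin d → ℕ) →₀ ℂ) :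
    Integrable f (μ ξ) ∧ aXi a ξ n = ((∫ x, f x ∂μ ξ : ℝ) : ℂ) := by
  obtain ⟨h1, h2⟩ := hmom ξ n hn
  simp only [rmom_eq_ofReal, hf] at h1 h2
  exact ⟨by simpa using h1.re, h2.trans integral_ofReal⟩

lemma integral_one_and_aXi_zero (ξ : (Fin d → ℕ) →₀ ℂ) :
    Integrable (fun _ => (1 : ℝ)) (μ ξ) ∧ aXi a ξ 0 = ((∫ _, 1 ∂μ ξ : ℝ) : ℂ) :=
  integrable_and_aXi_eq hmom truncIdx_zero (by simp) ξ

lemma integral_coord_and_aXi_single_one (i : Fin d) (ξ : (Fin d → ℕ) →₀ ℂ) :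
    Integrable (fun x => x i) (μ ξ) ∧ aXi a ξ (Pi.single i 1) = ((∫ x, x i ∂μ ξ : ℝ) : ℂ) :=
  integrable_and_aXi_eq hmom (truncIdx_single_one i) (by simp [prod_pow_single]) ξ

lemma integral_coord_sq_and_aXi_single_two (i : Fin d) (ξ : (Fin d → ℕ) →₀ ℂ) :
    Integrable (fun x => x i ^ 2) (μ ξ) ∧
      aXi a ξ (Pi.single i 2) = ((∫ x, x i ^ 2 ∂μ ξ : ℝ) : ℂ) :=
  integrable_and_aXi_eq hmom (truncIdx_single_two i) (by simp [prod_pow_single]) ξ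

lemma isFiniteMeasure_of_truncated (ξ : (Fin d → ℕ) →₀ ℂ) : IsFiniteMeasure (μ ξ) := by
  simpa [integrable_const_iff] using (integral_one_and_aXi_zero hmom ξ).1

omit hmom in
lemma integralParallelogram_of_truncated {G : Type*} [AddCommGroup G]
    (ι : G →+ (Fin d → ℕ) →₀ ℂ) {n : Fin d → ℕ} {f : (Fin d → ℝ) → ℝ}
    (hf : ∀ ξ, Integrable f (μ ξ) ∧ aXi a ξ n = ((∫ x, f x ∂μ ξ : ℝ) : ℂ)) :
    IntegralParallelogram (fun g => μ (ι g)) f := by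
  intro ξ η
  have := aXi_add_add_aXi_sub (a := a) n (ι ξ) (ι η)
  simp only [(hf _).2, ← map_add, ← map_sub] at this
  exact_mod_cast this

lemma add_self_le_of_truncated
    (hpos : ∀ ξ η : (Fin d → ℕ) →₀ ℂ, ∀ σ : Set (Fin d → ℝ), MeasurableSet σ →
      2 * μ η σ ≤ μ (ξ + η) σ + μ (ξ - η) σ) (ξ η : (Fin d → ℕ) →₀ ℂ) :
    μ η + μ η ≤ μ (η + ξ) + μ (η - ξ) := by
  have := isFiniteMeasure_of_truncated hmom
  have hle (ζ : (Fin d → ℕ) →₀ ℂ) {σ : Set (Fin d → ℝ)} (hσ : MeasurableSet σ) :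
      μ ζ σ ≤ μ (-ζ) σ := by
    have h := hpos 0 ζ σ hσ
    rw [zero_add, zero_sub, two_mul] at h
    exact (ENNReal.add_le_add_iff_left (measure_ne_top _ _)).1 h
  refine Measure.le_iff.2 fun σ hσ => ?_
  have h := hpos ξ η σ hσ
  have h' := hle (ξ - η) hσ
  rw [neg_sub] at h'
  rw [Measure.add_apply, Measure.add_apply, ← two_mul, add_comm η]
  exact h.trans (by gcongr)

lemma mass_add_integral_sq_eq (n : Fin d → ℕ) (i : Fin d) :
    ∫ _, (1 : ℝ) ∂μ (single (n + Pi.single i 1) 1) + ∫ x, x i ^ 2 ∂μ (single n 1) =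
      ((∫ x, x i ∂μ (single (n + Pi.single i 1) 1 + single n 1)) -
        ∫ x, x i ∂μ (single (n + Pi.single i 1) 1 - single n 1)) / 2 := by
  have h1 := (integral_one_and_aXi_zero hmom (single (n + Pi.single i 1) 1)).2
  have h2 := (integral_coord_sq_and_aXi_single_two hmom i (single n 1)).2
  have h3 := (integral_coord_and_aXi_single_one hmom i
    (single (n + Pi.single i 1) 1 + single n 1)).2
  have h4 := (integral_coord_and_aXi_single_one hmom i
    (single (n + Pi.single i 1) 1 - single n 1)).2
  have h5 := aXi_add_sub_aXi_sub_single (a := a) (Pi.single i 1) (n + Pi.single i 1) n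
  rw [h3, h4] at h5
  rw [aXi_single] at h1 h2
  have e1 : 0 + (n + Pi.single i 1) + (n + Pi.single i 1) = Pi.single i 2 + n + n := by
    rw [← one_add_one_eq_two, Pi.single_add]
    abel
  have e2 : Pi.single i 1 + (n + Pi.single i 1) + n = Pi.single i 2 + n + n := by
    rw [← one_add_one_eq_two, Pi.single_add]
    abel
  rw [e1] at h1
  rw [e2] at h5
  apply ofReal_injective
  push_cast
  rw [← h1, ← h2, h5]
  ring

end TruncatedFamily

/-- If a family of positive Borel measures solves the truncations `N₁ ∪ 2N₁` of `(a_n)` and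
satisfies `μ_0 = 0`, `μ_{ξ+η} + μ_{ξ-η} - 2μ_η ≥ 0`, then `(a_n)` is a moment multisequence. -/
theorem moment_of_truncated_family (d : ℕ) (hd : 1 ≤ d) (a : (Fin d → ℕ) → ℂ)
    (μ : ((Fin d → ℕ) →₀ ℂ) → Measure (Fin d → ℝ))
    (hmom : ∀ ξ : (Fin d → ℕ) →₀ ℂ, ∀ n : Fin d → ℕ, truncIdx n →
        Integrable (fun x => rmom x n) (μ ξ) ∧ aXi a ξ n = ∫ x, rmom x n ∂(μ ξ))
    (h0 : μ 0 = 0)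
    (hpos : ∀ ξ η : (Fin d → ℕ) →₀ ℂ, ∀ σ : Set (Fin d → ℝ), MeasurableSet σ →
        2 * μ η σ ≤ μ (ξ + η) σ + μ (ξ - η) σ) :
    ∃ ν : Measure (Fin d → ℝ), ∀ n : Fin d → ℕ,
        Integrable (fun x => rmom x n) ν ∧ a n = ∫ x, rmom x n ∂ν := by
  let ι : ((Fin d → ℕ) →₀ ℤ) →+ ((Fin d → ℕ) →₀ ℂ) :=
    Finsupp.mapRange.addMonoidHom (Int.castAddHom ℂ)
  have hι (n : Fin d → ℕ) : ι (single n 1) = single n 1 := by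
    simp [ι]
  have hfin := isFiniteMeasure_of_truncated hmom
  obtain ⟨ν, hν, hpar, hint, hmass, hcoord, hsq⟩ := exists_quadratic_family (fun g => μ (ι g))
    (fun ξ i => (integral_coord_sq_and_aXi_single_two hmom i _).1)
    (fun ξ η => by
      simpa only [map_add, map_sub] using add_self_le_of_truncated hmom hpos (ι ξ) (ι η))
    (integralParallelogram_of_truncated ι (integral_one_and_aXi_zero hmom))
    (fun i => integralParallelogram_of_truncated ι (integral_coord_and_aXi_single_one hmom i))
    (fun i => integralParallelogram_of_truncated ι
      (integral_coord_sq_and_aXi_single_two hmom i))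
  have hmass' (g : (Fin d → ℕ) →₀ ℤ) : (((ν g).real Set.univ : ℝ) : ℂ) = aXi a (ι g) 0 := by
    rw [hmass, (integral_one_and_aXi_zero hmom (ι g)).2]
    simp
  refine ⟨ν (single 0 1), fun n => ?_⟩
  obtain ⟨h1, h2⟩ := moments_of_quadratic_family ν hpar hint (fun n => single n 1)
    (fun n i => by
      have h := mass_add_integral_sq_eq hmom n i
      have h' := hsq (single n 1) i
      rw [hι] at h'
      rw [hmass, hcoord, hcoord, map_add, map_sub, hι, hι, ← h]
      simpa using h') n
  simp only [rmom_eq_ofReal]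
  refine ⟨h1.ofReal, ?_⟩
  rw [integral_complex_ofReal, h2]
  push_cast
  rw [hmass', hmass', map_add, map_sub, hι, hι, aXi_add_sub_aXi_sub_single]
  simp
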